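/- Let γ: ℝ/L → ℝ³ be a minimal inspection curve and suppose γ(t) lies in the interior of conv(γ) for some t ∈ ℝ/L. Then there exists a connected open set U ⊂ ℝ/L with t ∈ U such that γ maps the closure cl(U) injectively onto a line segment whose endpoints lie on the boundary ∂conv(γ). -/

import Mathlib

open Real Set MeasureTheory ENNReal

noncomputable section

abbrev E3 := EuclideanSpace ℝ (Fin 3)

/-- The lift of a curve `γ : ℝ/L → ℝ³` to `ℝ`, via the quotient map `ℝ → ℝ/L`. -/
def liftCurve (L : ℝ) (γ : AddCircle L → E3) : ℝ → E3 := fun s => γ s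

/-- An inspection curve is a closed rectifiable curve `γ : ℝ/L → ℝ³`, parameterized with
constant unit speed (`1`-Lipschitz with total variation `L` over one period), whose convex
hull contains the unit sphere centered at the origin. -/
def IsInspectionCurve (L : ℝ) (γ : AddCircle L → E3) : Prop :=
  0 < L ∧ Continuous γ ∧ LipschitzWith 1 (liftCurve L γ) ∧
    eVariationOn (liftCurve L γ) (Set.Icc 0 L) = ENNReal.ofReal L ∧
    Metric.sphere (0 : E3) 1 ⊆ convexHull ℝ (Set.range γ)

/-- A minimal inspection curve is an inspection curve of minimal length. -/
def IsMinInspectionCurve (L : ℝ) (γ : AddCircle L → E3) : Prop :=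
  IsInspectionCurve L γ ∧
    ∀ (L' : ℝ) (γ' : AddCircle L' → E3), IsInspectionCurve L' γ' → L ≤ L'

/-- In finite dimension the convex hull of a compact set is compact, by Carathéodory. -/
theorem isCompact_convexHull_of_isCompact {E : Type*} [NormedAddCommGroup E] [NormedSpace ℝ E]
    [FiniteDimensional ℝ E] {s : Set E} (hs : IsCompact s) : IsCompact (convexHull ℝ s) := by
  let F : ∀ k : ℕ, (Fin k → ℝ) × (Fin k → E) → E := fun k p => ∑ i, p.1 i • p.2 i
  have hunion : convexHull ℝ s = ⋃ k ∈ Finset.range (Module.finrank ℝ E + 2),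
      F k '' (stdSimplex ℝ (Fin k) ×ˢ Set.univ.pi fun _ => s) := by
    ext x
    simp only [mem_iUnion, Finset.mem_range, exists_prop]
    constructor
    · intro hx
      obtain ⟨ι, _, z, w, hz, hind, hw, hw1, rfl⟩ := eq_pos_convex_span_of_mem_convexHull hx
      let e := Fintype.equivFin ι
      refine ⟨Fintype.card ι, ?_, (fun i => w (e.symm i), fun i => z (e.symm i)), ⟨⟨?_, ?_⟩, ?_⟩, ?_⟩
      · have h := hind.card_le_finrank_succ
        have h' := Submodule.finrank_le (vectorSpan ℝ (Set.range z))
        omega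
      · exact fun i => (hw _).le
      · exact (e.symm.sum_comp w).trans hw1
      · exact fun i _ => hz ⟨_, rfl⟩
      · exact e.symm.sum_comp fun i => w i • z i
    · rintro ⟨k, -, ⟨w, z⟩, ⟨⟨hw, hw1⟩, hz⟩, rfl⟩
      exact (convex_convexHull ℝ s).sum_mem (fun i _ => hw i) hw1
        fun i _ => subset_convexHull ℝ s (hz i (mem_univ i))
  rw [hunion]
  refine (Finset.range _).isCompact_biUnion fun k _ => ?_
  refine ((isCompact_stdSimplex ℝ (Fin k)).prod (isCompact_univ_pi fun _ => hs)).image ?_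
  fun_prop

/-- Every compact convex set is contained in the convex hull of any compact set that contains
its extreme points. -/
theorem subset_convexHull_of_extremePoints_subset {E : Type*} [NormedAddCommGroup E]
    [NormedSpace ℝ E] [FiniteDimensional ℝ E] {K s : Set E} (hK : IsCompact K)
    (hconv : Convex ℝ K) (hs : IsCompact s) (h : K.extremePoints ℝ ⊆ s) :
    K ⊆ convexHull ℝ s := by
  rw [← closure_convexHull_extremePoints hK hconv]
  exact closure_minimal (convexHull_mono h) (isCompact_convexHull_of_isCompact hs).isClosed

section UnitSpeed

variable {E : Type*} [PseudoMetricSpace E] {f : ℝ → E} {p q : ℝ}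

theorem LipschitzOnWith.eVariationOn_Icc_le (hf : LipschitzOnWith 1 f (Icc p q)) :
    eVariationOn f (Icc p q) ≤ ENNReal.ofReal (q - p) := by
  have h := hf.comp_eVariationOn_le (g := id) (s := Icc p q) (mapsTo_id _)
  simpa [eVariationOn_id_Icc] using h

/-- A `1`-Lipschitz curve whose length is the length of its parameter interval has unit speed. -/
theorem LipschitzOnWith.hasUnitSpeedOn_Icc (hf : LipschitzOnWith 1 f (Icc p q))
    (hv : ENNReal.ofReal (q - p) ≤ eVariationOn f (Icc p q)) : HasUnitSpeedOn f (Icc p q) := by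
  refine hasConstantSpeedOnWith_iff_ordered.2 fun x hx y hy hxy => ?_
  have hsub : Icc p q ∩ Icc x y = Icc x y :=
    inter_eq_right.2 (Icc_subset_Icc hx.1 hy.2)
  rw [hsub, NNReal.coe_one, one_mul]
  have hA := (hf.mono (Icc_subset_Icc_right hx.2)).eVariationOn_Icc_le
  have hB := (hf.mono (Icc_subset_Icc hx.1 hy.2)).eVariationOn_Icc_le
  have hC := (hf.mono (Icc_subset_Icc_left hy.1)).eVariationOn_Icc_le
  refine le_antisymm hB ?_
  have h1 := eVariationOn.Icc_add_Icc f (s := univ) hx.1 hxy (mem_univ _)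
  have h2 := eVariationOn.Icc_add_Icc f (s := univ) (hx.1.trans hxy) hy.2 (mem_univ _)
  simp only [univ_inter] at h1 h2
  rw [← h2, ← h1] at hv
  have hB' := ne_top_of_le_ne_top ENNReal.ofReal_ne_top hB
  rw [ENNReal.ofReal_le_iff_le_toReal hB']
  have hv' : ENNReal.ofReal (q - p) ≤ ENNReal.ofReal
      ((x - p) + (eVariationOn f (Icc x y)).toReal + (q - y)) := by
    rw [ENNReal.ofReal_add (add_nonneg (sub_nonneg.2 hx.1) ENNReal.toReal_nonneg)
      (sub_nonneg.2 hy.2), ENNReal.ofReal_add (sub_nonneg.2 hx.1) ENNReal.toReal_nonneg,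
      ENNReal.ofReal_toReal hB']
    exact hv.trans (by gcongr)
  have hnn : 0 ≤ (x - p) + (eVariationOn f (Icc x y)).toReal + (q - y) :=
    add_nonneg (add_nonneg (sub_nonneg.2 hx.1) ENNReal.toReal_nonneg) (sub_nonneg.2 hy.2)
  rw [ENNReal.ofReal_le_ofReal_iff hnn] at hv'
  linarith

theorem HasUnitSpeedOn.eVariationOn_Icc (hf : HasUnitSpeedOn f (Icc p q)) (hpq : p ≤ q) :
    eVariationOn f (Icc p q) = ENNReal.ofReal (q - p) := by
  simpa using hf (left_mem_Icc.2 hpq) (right_mem_Icc.2 hpq)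

theorem HasUnitSpeedOn.dist_le (hf : HasUnitSpeedOn f (Icc p q)) {x y : ℝ} (hx : p ≤ x)
    (hxy : x ≤ y) (hy : y ≤ q) : dist (f x) (f y) ≤ y - x := by
  have hxm : x ∈ Icc p q := ⟨hx, hxy.trans hy⟩
  have hym : y ∈ Icc p q := ⟨hx.trans hxy, hy⟩
  have h := eVariationOn.edist_le f (s := Icc p q ∩ Icc x y) ⟨hxm, left_mem_Icc.2 hxy⟩
    ⟨hym, right_mem_Icc.2 hxy⟩
  rw [hf hxm hym, NNReal.coe_one, one_mul, edist_dist,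
    ENNReal.ofReal_le_ofReal_iff (sub_nonneg.2 hxy)] at h
  exact h

theorem HasUnitSpeedOn.continuousOn (hf : HasUnitSpeedOn f (Icc p q)) :
    ContinuousOn f (Icc p q) := by
  refine (LipschitzOnWith.of_dist_le_mul (K := 1) fun x hx y hy => ?_).continuousOn
  rw [NNReal.coe_one, one_mul, Real.dist_eq]
  rcases le_total x y with h | h
  · exact (hf.dist_le hx.1 h hy.2).trans (by rw [abs_sub_comm]; exact le_abs_self _)
  · rw [dist_comm]
    exact (hf.dist_le hy.1 h hx.2).trans (le_abs_self _)

theorem HasUnitSpeedOn.mono_Icc (hf : HasUnitSpeedOn f (Icc p q)) {x y : ℝ} (hx : p ≤ x)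
    (hy : y ≤ q) : HasUnitSpeedOn f (Icc x y) := by
  intro u hu v hv
  have hu' : u ∈ Icc p q := Icc_subset_Icc hx hy hu
  have hv' : v ∈ Icc p q := Icc_subset_Icc hx hy hv
  rw [← hf hu' hv', inter_eq_right.2 (Icc_subset_Icc hu.1 hv.2),
    inter_eq_right.2 (Icc_subset_Icc hu'.1 hv'.2)]

theorem HasUnitSpeedOn.congr {g : ℝ → E} {s : Set ℝ} (hf : HasUnitSpeedOn f s)
    (h : EqOn g f s) : HasUnitSpeedOn g s := fun x hx y hy => by
  rw [← hf hx hy]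
  exact eVariationOn.congr (h.mono inter_subset_left)

theorem HasUnitSpeedOn.comp_add_left (c : ℝ) (hf : HasUnitSpeedOn f (Icc (c + p) (c + q))) :
    HasUnitSpeedOn (fun s => f (c + s)) (Icc p q) := by
  intro x hx y hy
  have h := hf (x := c + x) ⟨by linarith [hx.1], by linarith [hx.2]⟩
    (y := c + y) ⟨by linarith [hy.1], by linarith [hy.2]⟩
  rw [add_sub_add_left_eq_sub] at h
  rw [← h, ← Set.image_const_add_Icc, ← Set.image_const_add_Icc,
    ← image_inter (add_right_injective c)]
  exact eVariationOn.comp_eq_of_monotoneOn f (fun s => c + s)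
    fun _ _ _ _ h => add_le_add_right h c

/-- A periodic curve that has unit speed on one period has unit speed on every period. -/
theorem Function.Periodic.hasUnitSpeedOn_comp_add {L : ℝ} (hper : Function.Periodic f L)
    (hL : 0 < L) (hf : HasUnitSpeedOn f (Icc 0 L)) (b : ℝ) :
    HasUnitSpeedOn (fun s => f (b + s)) (Icc 0 L) := by
  obtain ⟨r, hr, hbr⟩ : ∃ r ∈ Ico 0 L, ∀ s, f (b + s) = f (r + s) := by
    obtain ⟨k, hk, -⟩ := existsUnique_add_zsmul_mem_Ico hL b 0
    refine ⟨b + k • L, by simpa using hk, fun s => ?_⟩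
    rw [add_right_comm, hper.zsmul k]
  simp only [hbr]
  refine HasUnitSpeedOn.Icc_Icc (y := L - r) ?_ ?_
  · exact (hf.mono_Icc (by linarith [hr.1]) (by linarith)).comp_add_left r
  · have h : HasUnitSpeedOn (fun s => f (r - L + s)) (Icc (L - r) L) :=
      (hf.mono_Icc (by linarith) (by linarith [hr.2])).comp_add_left (r - L)
    refine h.congr fun s _ => ?_
    change f (r + s) = f (r - L + s)
    rw [← hper (r - L + s)]
    congr 1
    ring

end UnitSpeed

/-- A closed unit speed curve on `[0, L]` with the unit sphere in its convex hull descends to an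
inspection curve on `ℝ/L`. -/
theorem isInspectionCurve_liftIco {L : ℝ} (hL : 0 < L) {g : ℝ → E3}
    (hg : HasUnitSpeedOn g (Icc 0 L)) (hclosed : g 0 = g L)
    (hsphere : Metric.sphere (0 : E3) 1 ⊆ convexHull ℝ (g '' Icc 0 L)) :
    haveI : Fact (0 < L) := ⟨hL⟩
    IsInspectionCurve L (AddCircle.liftIco L 0 g) := by
  have : Fact (0 < L) := ⟨hL⟩
  set h : ℝ → E3 := liftCurve L (AddCircle.liftIco L 0 g) with hh
  have hper : Function.Periodic h L := fun x => by simp [hh, liftCurve]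
  have heq : EqOn h g (Icc 0 L) := by
    intro x hx
    rcases hx.2.eq_or_lt with rfl | hlt
    · have h0 : h x = h 0 := by simpa using hper 0
      rw [h0, ← hclosed]
      exact AddCircle.liftIco_zero_coe_apply ⟨le_rfl, hL⟩
    · exact AddCircle.liftIco_zero_coe_apply ⟨hx.1, hlt⟩
  have hunit : HasUnitSpeedOn h (Icc 0 L) := hg.congr heq
  have hle : ∀ x y, x ≤ y → dist (h x) (h y) ≤ y - x := by
    intro x y hxy
    rcases le_total (y - x) L with hyx | hyx
    · have := (hper.hasUnitSpeedOn_comp_add hL hunit x).dist_le le_rfl (sub_nonneg.2 hxy) hyx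
      simpa using this
    · obtain ⟨k, hk, -⟩ := existsUnique_add_zsmul_mem_Ico hL y x
      have := (hper.hasUnitSpeedOn_comp_add hL hunit x).dist_le le_rfl
        (y := y + k • L - x) (by linarith [hk.1]) (by linarith [hk.2])
      simp only [add_zero, add_sub_cancel, sub_zero, hper.zsmul k y] at this
      linarith [hk.2]
  have hLip : LipschitzWith 1 h := by
    refine LipschitzWith.of_dist_le_mul fun x y => ?_
    rw [NNReal.coe_one, one_mul, Real.dist_eq]
    rcases le_total x y with hxy | hxy
    · exact (hle x y hxy).trans (by rw [abs_sub_comm]; exact le_abs_self _)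
    · rw [dist_comm]
      exact (hle y x hxy).trans (le_abs_self _)
  refine ⟨hL, AddCircle.liftIco_zero_continuous hclosed hg.continuousOn, hLip, ?_, ?_⟩
  · rw [← hh, hunit.eVariationOn_Icc hL.le, sub_zero]
  · refine hsphere.trans (convexHull_mono ?_)
    rintro _ ⟨x, hx, rfl⟩
    exact ⟨(x : AddCircle L), heq hx⟩

/-- Any two points at distance `d` are joined by a unit speed segment on `[c, c + d]`. -/
theorem hasUnitSpeedOn_lineMap {E : Type*} [NormedAddCommGroup E] [NormedSpace ℝ E]
    (x y : E) (c : ℝ) :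
    HasUnitSpeedOn (fun s : ℝ => AffineMap.lineMap x y ((s - c) / dist x y))
      (Icc c (c + dist x y)) := by
  rcases (dist_nonneg (x := x) (y := y)).eq_or_lt with hd | hd
  · rw [← hd, add_zero, Icc_self]
    exact hasConstantSpeedOnWith_of_subsingleton _ subsingleton_singleton _
  · have hdist : ∀ s u : ℝ, dist (AffineMap.lineMap x y ((s - c) / dist x y) : E)
        (AffineMap.lineMap x y ((u - c) / dist x y)) = dist s u := by
      intro s u
      rw [dist_lineMap_lineMap, Real.dist_eq, ← sub_div, sub_sub_sub_cancel_right, abs_div,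
        abs_of_pos hd, div_mul_cancel₀ _ hd.ne', Real.dist_eq]
    have hiso : Isometry fun s : ℝ => (AffineMap.lineMap x y ((s - c) / dist x y) : E) :=
      Isometry.of_dist_eq hdist
    refine hiso.lipschitz.lipschitzOnWith.hasUnitSpeedOn_Icc ?_
    have hcd : c ≤ c + dist x y := by linarith
    refine le_trans (le_of_eq ?_) (eVariationOn.edist_le _ (right_mem_Icc.2 hcd)
      (left_mem_Icc.2 hcd))
    rw [hiso.edist_eq, edist_dist, Real.dist_eq, add_sub_cancel_left, abs_of_pos hd]

/-- Replacing the arc of a unit speed closed curve over `[a, b]` by a chord gives an inspection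
curve of the corresponding length, provided the rest of the curve still sees the sphere. -/
theorem exists_isInspectionCurve_of_chord {L a b : ℝ} {f : ℝ → E3} (hL : 0 < L)
    (hper : Function.Periodic f L) (hf : HasUnitSpeedOn f (Icc 0 L)) (hab : a ≤ b)
    (hba : b < a + L)
    (hsphere : Metric.sphere (0 : E3) 1 ⊆ convexHull ℝ (f '' Icc b (a + L))) :
    ∃ γ' : AddCircle (a + L - b + dist (f a) (f b)) → E3,
      IsInspectionCurve (a + L - b + dist (f a) (f b)) γ' := by
  set c := a + L - b with hc
  have hc0 : 0 < c := by linarith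
  let g : ℝ → E3 := fun s =>
    if s ≤ c then f (b + s) else AffineMap.lineMap (f a) (f b) ((s - c) / dist (f a) (f b))
  have hbc : f (b + c) = f a := by rw [hc, add_sub_cancel, hper]
  have hg1 : EqOn g (fun s => f (b + s)) (Icc 0 c) := fun s hs => if_pos hs.2
  have hg2 : EqOn g (fun s => AffineMap.lineMap (f a) (f b) ((s - c) / dist (f a) (f b)))
      (Icc c (c + dist (f a) (f b))) := by
    intro s hs
    rcases hs.1.eq_or_lt with rfl | hlt
    · simp [g, hbc]
    · exact if_neg hlt.not_ge
  have hunit : HasUnitSpeedOn g (Icc 0 (c + dist (f a) (f b))) := by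
    refine HasUnitSpeedOn.Icc_Icc (y := c) ?_ ((hasUnitSpeedOn_lineMap _ _ c).congr hg2)
    exact ((hper.hasUnitSpeedOn_comp_add hL hf b).mono_Icc le_rfl (by linarith)).congr hg1
  have hd := dist_nonneg (x := f a) (y := f b)
  refine ⟨_, isInspectionCurve_liftIco (by linarith) hunit ?_ ?_⟩
  · rw [hg1 (left_mem_Icc.2 hc0.le), hg2 (right_mem_Icc.2 (by linarith))]
    beta_reduce
    rw [add_zero, add_sub_cancel_left]
    rcases eq_or_ne (f a) (f b) with h | h
    · simp [h]
    · rw [div_self (dist_ne_zero.2 h), AffineMap.lineMap_apply_one]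
  · refine hsphere.trans (convexHull_mono ?_)
    rintro _ ⟨s, hs, rfl⟩
    have hs' : s - b ∈ Icc 0 c := ⟨by linarith [hs.1], by linarith [hs.2]⟩
    refine ⟨s - b, ⟨hs'.1, by linarith [hs'.2]⟩, ?_⟩
    rw [hg1 hs']
    exact congrArg f (add_sub_cancel b s)

/-- A `1`-Lipschitz curve whose endpoints are at maximal distance is an isometrically
parameterized segment. -/
theorem LipschitzWith.eq_lineMap_of_le_dist {E : Type*} [NormedAddCommGroup E] [NormedSpace ℝ E]
    [StrictConvexSpace ℝ E] {f : ℝ → E} (hf : LipschitzWith 1 f) {a b : ℝ}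
    (h : b - a ≤ dist (f a) (f b)) {s : ℝ} (hs : s ∈ Icc a b) :
    f s = AffineMap.lineMap (f a) (f b) ((s - a) / (b - a)) := by
  have hle : ∀ x y, x ≤ y → dist (f x) (f y) ≤ y - x := fun x y hxy => by
    have := hf.dist_le_mul x y
    rwa [NNReal.coe_one, one_mul, Real.dist_eq, abs_sub_comm, abs_of_nonneg (sub_nonneg.2 hxy)]
      at this
  have h1 := hle a s hs.1
  have h2 := hle s b hs.2
  have h3 := hle a b (hs.1.trans hs.2)
  have h4 := dist_triangle (f a) (f s) (f b)
  have hd : dist (f a) (f b) = b - a := le_antisymm h3 h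
  rcases (hs.1.trans hs.2).eq_or_lt with rfl | hab
  · obtain rfl : s = a := le_antisymm hs.2 hs.1
    simp
  have hne : b - a ≠ 0 := (sub_pos.2 hab).ne'
  apply eq_lineMap_of_dist_eq_mul_of_dist_eq_mul
  · rw [hd, div_mul_cancel₀ _ hne]
    linarith
  · rw [hd, sub_mul, div_mul_cancel₀ _ hne]
    linarith

/-- If a minimal inspection curve `γ` meets the interior of its convex hull
at some time `t`, then there is a connected open set `U ∋ t` in `ℝ/L` whose closure is mapped
injectively by `γ` onto a line segment with endpoints on the boundary of the convex hull. -/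
theorem minimal_inspection_interior_segment
    (L : ℝ) (γ : AddCircle L → E3) (hγ : IsMinInspectionCurve L γ)
    (t : AddCircle L)
    (ht : γ t ∈ interior (convexHull ℝ (Set.range γ))) :
    ∃ U : Set (AddCircle L), IsOpen U ∧ IsConnected U ∧ t ∈ U ∧
      Set.InjOn γ (closure U) ∧
      ∃ x y : E3, x ∈ frontier (convexHull ℝ (Set.range γ)) ∧
        y ∈ frontier (convexHull ℝ (Set.range γ)) ∧
        γ '' closure U = segment ℝ x y := by
  obtain ⟨⟨hL, hcont, hLip, hvar, hsphere⟩, hmin⟩ := hγ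
  have : Fact (0 < L) := ⟨hL⟩
  obtain ⟨t₀, rfl⟩ := QuotientAddGroup.mk_surjective t
  set K := convexHull ℝ (range γ) with hK
  set f : ℝ → E3 := liftCurve L γ with hf
  have hper : Function.Periodic f L := fun x => by simp [hf, liftCurve]
  have hunit : HasUnitSpeedOn f (Icc 0 L) :=
    hLip.lipschitzOnWith.hasUnitSpeedOn_Icc (by rw [hvar, sub_zero])
  have hKc : IsCompact K := isCompact_convexHull_of_isCompact (isCompact_range hcont)
  have hKconv : Convex ℝ K := convex_convexHull ℝ _
  have hfK : ∀ s, f s ∈ K := fun s => subset_convexHull ℝ _ ⟨(s : AddCircle L), rfl⟩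
  have ht₀ : f t₀ ∈ interior K := ht
  have hclosed : IsClosed {s | f s ∉ interior K} :=
    (isOpen_interior.preimage hLip.continuous).isClosed_compl
  -- extreme points are attained by the curve, and outside the interior
  have hext : ∀ p ∈ K.extremePoints ℝ, ∀ x : ℝ, ∃ s ∈ Ico x (x + L), f s = p ∧ p ∉ interior K := by
    intro p hp x
    obtain ⟨u, rfl⟩ := extremePoints_convexHull_subset hp
    obtain ⟨s, rfl⟩ := QuotientAddGroup.mk_surjective u
    obtain ⟨k, hk, -⟩ := existsUnique_add_zsmul_mem_Ico hL s x
    refine ⟨s + k • L, hk, hper.zsmul k s, fun hi => ?_⟩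
    exact disjoint_left.1 (disjoint_interior_extremePoints K) hi hp
  obtain ⟨p, hp⟩ := hKc.extremePoints_nonempty ⟨_, hfK t₀⟩
  obtain ⟨a₀, ha₀, rfl, hpint⟩ := hext p hp (t₀ - L)
  have ha₀' : f (a₀ + L) ∉ interior K := by rwa [hper]
  obtain ⟨a, ⟨ha, haI⟩, hamax⟩ := (isCompact_Icc.inter_left hclosed).exists_isGreatest
    (⟨a₀, hpint, le_rfl, by linarith [ha₀.2]⟩ : ({s | f s ∉ interior K} ∩ Icc a₀ t₀).Nonempty)
  obtain ⟨b, ⟨hb, hbI⟩, hbmin⟩ := (isCompact_Icc.inter_left hclosed).exists_isLeast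
    (⟨a₀ + L, ha₀', by linarith [ha₀.1], le_rfl⟩ :
      ({s | f s ∉ interior K} ∩ Icc t₀ (a₀ + L)).Nonempty)
  have hat : a < t₀ := lt_of_le_of_ne haI.2 fun h => ha (h ▸ ht₀)
  have htb : t₀ < b := lt_of_le_of_ne hbI.1 fun h => hb (h ▸ ht₀)
  have hgap : ∀ s, a < s → s < b → f s ∈ interior K := by
    intro s has hsb
    by_contra hs
    rcases le_total s t₀ with h | h
    · exact has.not_ge (hamax ⟨hs, haI.1.trans has.le, h⟩)
    · exact hsb.not_ge (hbmin ⟨hs, h, hsb.le.trans hbI.2⟩)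
  have hKsub : K ⊆ convexHull ℝ (f '' Icc b (a + L)) := by
    refine subset_convexHull_of_extremePoints_subset hKc hKconv
      (isCompact_Icc.image hLip.continuous) fun p hp => ?_
    obtain ⟨s, hs, rfl, hsi⟩ := hext p hp a
    rcases hs.1.eq_or_lt with rfl | has
    · exact ⟨a + L, right_mem_Icc.2 (hbI.2.trans (by linarith [haI.1])), hper a⟩
    · exact ⟨s, ⟨not_lt.1 fun h => hsi (hgap s has h), hs.2.le⟩, rfl⟩
  have hba : b < a + L := by
    refine lt_of_le_of_ne (hbI.2.trans (by linarith [haI.1])) fun h => hb ?_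
    have := hKsub (hfK t₀)
    rw [← h, Icc_self, image_singleton, convexHull_singleton, mem_singleton_iff] at this
    exact this ▸ ht₀
  obtain ⟨γ', hγ'⟩ := exists_isInspectionCurve_of_chord hL hper hunit (hat.trans htb).le hba
    (hsphere.trans hKsub)
  have hlen : b - a ≤ dist (f a) (f b) := by linarith [hmin _ γ' hγ']
  have hline : ∀ s ∈ Icc a b, f s = AffineMap.lineMap (f a) (f b) ((s - a) / (b - a)) :=
    fun s hs => hLip.eq_lineMap_of_le_dist hlen hs
  have hab : 0 < b - a := by linarith
  have hfab : f a ≠ f b := dist_pos.1 (hab.trans_le hlen)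
  have hcl : closure (((↑) : ℝ → AddCircle L) '' Ioo a b) = (↑) '' Icc a b := by
    refine subset_antisymm (closure_minimal (image_mono Ioo_subset_Icc_self) ?_) ?_
    · exact (isCompact_Icc.image (AddCircle.continuous_mk' L)).isClosed
    · rw [← closure_Ioo (by linarith : a ≠ b)]
      exact image_closure_subset_closure_image (AddCircle.continuous_mk' L)
  refine ⟨(↑) '' Ioo a b, QuotientAddGroup.isOpenMap_coe _ isOpen_Ioo,
    (isConnected_Ioo (hat.trans htb)).image _ (AddCircle.continuous_mk' L).continuousOn,
    ⟨t₀, ⟨hat, htb⟩, rfl⟩, ?_, f a, f b, ⟨subset_closure (hfK a), ha⟩,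
    ⟨subset_closure (hfK b), hb⟩, ?_⟩
  · rw [hcl]
    rintro _ ⟨x, hx, rfl⟩ _ ⟨y, hy, rfl⟩ hxy
    have h : f x = f y := hxy
    rw [hline x hx, hline y hy] at h
    have h' := AffineMap.lineMap_injective ℝ hfab h
    rw [div_left_inj' hab.ne', sub_left_inj] at h'
    rw [h']
  · rw [hcl, image_image, segment_eq_image_lineMap]
    ext q
    constructor
    · rintro ⟨s, hs, rfl⟩
      exact ⟨(s - a) / (b - a), ⟨div_nonneg (by linarith [hs.1]) hab.le,
        (div_le_one hab).2 (by linarith [hs.2])⟩, (hline s hs).symm⟩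
    · rintro ⟨θ, hθ, rfl⟩
      have hs : a + θ * (b - a) ∈ Icc a b :=
        ⟨by nlinarith [hθ.1], by nlinarith [hθ.2]⟩
      refine ⟨a + θ * (b - a), hs, (hline _ hs).trans ?_⟩
      rw [add_sub_cancel_left, mul_div_cancel_right₀ _ hab.ne']
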